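/- For any n ≥ 2 and any k ≥ 1, the set of k-tuples (A₁,…,A_k) of matrices in GL(n,ℝ) that do NOT form a free basis of the subgroup they generate (i.e., for which the homomorphism from the free group of rank k to GL(n,ℝ) sending the i-th free generator to Aᵢ fails to be injective) has Lebesgue measure zero as a subset of (M_n(ℝ))^k ≅ ℝ^{kn²}. In particular, almost all k-generated subgroups of GL(n,ℝ) are free of rank k. -/

import Mathlib

open MeasureTheory

/-- A measurable set is null for Haar measure as soon as all lines through some point meet it in
a countable set. -/
theorem addHaar_eq_zero_of_countable_lines {E : Type*} [NormedAddCommGroup E] [NormedSpace ℝ E]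
    [FiniteDimensional ℝ E] [MeasurableSpace E] [BorelSpace E] (μ : Measure E)
    [μ.IsAddHaarMeasure] {S : Set E} (hS : MeasurableSet S) (x₀ : E)
    (h : ∀ v : E, {t : ℝ | x₀ + t • v ∈ S}.Countable) : μ S = 0 := by
  have hm : MeasurableSet {p : E × ℝ | x₀ + p.2 • p.1 ∉ S} := by
    have hc : Measurable fun p : E × ℝ => x₀ + p.2 • p.1 := by fun_prop
    exact hc hS.compl
  have h₁ : ∀ᵐ v ∂μ, ∀ᵐ t : ℝ, x₀ + t • v ∉ S := by
    refine Filter.Eventually.of_forall fun v => ?_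
    simpa using! (h v).ae_notMem volume
  have h₂ : ∀ᵐ t : ℝ, ∀ᵐ v ∂μ, x₀ + t • v ∉ S := (Measure.ae_ae_comm hm).1 h₁
  obtain ⟨t, ht, ht0⟩ := (h₂.and (Measure.ae_ne volume 0)).exists
  have h₃ : μ ((t • ·) ⁻¹' ((x₀ + ·) ⁻¹' S)) = 0 := by
    simpa [ae_iff] using! ht
  rw [Measure.addHaar_preimage_smul μ ht0, measure_preimage_add, mul_eq_zero] at h₃
  refine h₃.resolve_left ?_
  simp [ht0]

namespace Matrix

variable {κ ι R S : Type*} [Fintype ι] [DecidableEq ι] [CommRing R] [CommRing S]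

/-- Evaluation of a word in letters and formal inverses at a tuple of square matrices, with inverses
replaced by adjugates. -/
def adjugateWord (A : κ → Matrix ι ι R) (L : List (κ × Bool)) : Matrix ι ι R :=
  (L.map fun p => if p.2 then A p.1 else (A p.1).adjugate).prod

/-- The product of the determinants of the letters occurring inverted in a word. -/
def invLetterDet (A : κ → Matrix ι ι R) (L : List (κ × Bool)) : R :=
  (L.map fun p => if p.2 then 1 else (A p.1).det).prod

/-- The matrix, polynomial in the entries of `A`, whose vanishing expresses that the word `L`
is a relation between the matrices `A i`. -/
def relator (A : κ → Matrix ι ι R) (L : List (κ × Bool)) : Matrix ι ι R :=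
  adjugateWord A L - invLetterDet A L • 1

theorem map_adjugateWord (f : R →+* S) (A : κ → Matrix ι ι R) (L : List (κ × Bool)) :
    f.mapMatrix (adjugateWord A L) = adjugateWord (fun i => f.mapMatrix (A i)) L := by
  rw [adjugateWord, adjugateWord, map_list_prod, List.map_map]
  congr 2
  ext1 p
  simp only [Function.comp_apply]
  split_ifs
  · rfl
  · exact RingHom.map_adjugate f _

theorem map_invLetterDet (f : R →+* S) (A : κ → Matrix ι ι R) (L : List (κ × Bool)) :
    f (invLetterDet A L) = invLetterDet (fun i => f.mapMatrix (A i)) L := by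
  rw [invLetterDet, invLetterDet, map_list_prod, List.map_map]
  congr 2
  ext1 p
  simp only [Function.comp_apply]
  split_ifs
  · exact map_one f
  · exact RingHom.map_det f _

theorem map_relator (f : R →+* S) (A : κ → Matrix ι ι R) (L : List (κ × Bool)) :
    f.mapMatrix (relator A L) = relator (fun i => f.mapMatrix (A i)) L := by
  rw [relator, relator, map_sub, map_adjugateWord, ← map_invLetterDet]
  congr 1
  ext i j
  simp [Matrix.one_apply, apply_ite f]

theorem continuous_relator [TopologicalSpace R] [IsTopologicalRing R] (L : List (κ × Bool)) :
    Continuous fun A : κ → Matrix ι ι R => relator A L := by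
  have hW : Continuous fun A : κ → Matrix ι ι R => adjugateWord A L := by
    refine continuous_list_prod L fun p _ => ?_
    by_cases hp : p.2
    · simpa [hp] using continuous_apply p.1
    · simpa [hp] using (continuous_apply p.1).matrix_adjugate
  have hD : Continuous fun A : κ → Matrix ι ι R => invLetterDet A L := by
    refine continuous_list_prod L fun p _ => ?_
    by_cases hp : p.2
    · simpa [hp] using continuous_const
    · simpa [hp] using (continuous_apply p.1).matrix_det
  exact hW.sub (hD.smul continuous_const)

theorem adjugateWord_coe (A : κ → GL ι R) (L : List (κ × Bool)) :
    adjugateWord (fun i => (A i : Matrix ι ι R)) L =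
      invLetterDet (fun i => (A i : Matrix ι ι R)) L •
        (FreeGroup.lift A (FreeGroup.mk L) : Matrix ι ι R) := by
  induction L with
  | nil => simp [adjugateWord, invLetterDet]
  | cons p L ih =>
    obtain ⟨i, b⟩ := p
    simp only [adjugateWord, invLetterDet, FreeGroup.lift_mk, List.map_cons, List.prod_cons,
      Units.val_mul] at ih ⊢
    rw [ih]
    cases b with
    | true => simp
    | false =>
      have hdet : IsUnit (A i : Matrix ι ι R).det :=
        (Matrix.isUnit_iff_isUnit_det _).1 (A i).isUnit
      have hadj : (A i : Matrix ι ι R).adjugate =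
          (A i : Matrix ι ι R).det • ((A i)⁻¹ : GL ι R).val := by
        rw [Matrix.coe_units_inv, Matrix.inv_def, smul_smul, Ring.mul_inverse_cancel _ hdet,
          one_smul]
      simp [hadj, smul_smul, mul_comm]

theorem isUnit_invLetterDet (A : κ → GL ι R) (L : List (κ × Bool)) :
    IsUnit (invLetterDet (fun i => (A i : Matrix ι ι R)) L) := by
  refine List.prod_isUnit fun d hd => ?_
  obtain ⟨p, -, rfl⟩ := List.mem_map.1 hd
  split_ifs
  · exact isUnit_one
  · exact (Matrix.isUnit_iff_isUnit_det _).1 (A p.1).isUnit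

theorem relator_coe_eq_zero_iff (A : κ → GL ι R) (L : List (κ × Bool)) :
    relator (fun i => (A i : Matrix ι ι R)) L = 0 ↔ FreeGroup.lift A (FreeGroup.mk L) = 1 := by
  rw [relator, adjugateWord_coe, ← smul_sub, (isUnit_invLetterDet A L).smul_eq_zero, sub_eq_zero,
    Units.val_eq_one]

/-- The zero set of a relator meets each line through a point outside it in a finite set. -/
theorem finite_relator_line_eq_zero [IsDomain R] {A : κ → Matrix ι ι R} {L : List (κ × Bool)}
    (hA : relator A L ≠ 0) (B : κ → Matrix ι ι R) :
    {t : R | relator (A + t • B) L = 0}.Finite := by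
  obtain ⟨i, j, hij⟩ : ∃ i j, relator A L i j ≠ 0 := by
    by_contra! h
    exact hA (Matrix.ext h)
  let Q : κ → Matrix ι ι (Polynomial R) := fun l =>
    (A l).map Polynomial.C + (Polynomial.X : Polynomial R) • (B l).map Polynomial.C
  have hQ (t : R) : (relator Q L i j).eval t = relator (A + t • B) L i j := by
    have h := congrFun (congrFun (map_relator (Polynomial.evalRingHom t) Q L) i) j
    have hl : (fun l => (Polynomial.evalRingHom t).mapMatrix (Q l)) = A + t • B := by
      ext l a b
      simp [Q, mul_comm t]
    rw [hl] at h
    exact h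
  have hne : relator Q L i j ≠ 0 := by
    intro h0
    have h := hQ 0
    rw [h0] at h
    simp only [Polynomial.eval_zero, zero_smul, add_zero] at h
    exact hij h.symm
  refine (Polynomial.finite_setOfPred_isRoot hne).subset fun t ht => ?_
  have ht' : relator (A + t • B) L = 0 := ht
  simp [Polynomial.IsRoot, hQ, ht']

/-- The matrix of the Möbius transformation `x ↦ p - 1 / (x - q)`, which maps the exterior of the
unit interval around `q` into the unit interval around `p`. -/
def schottky (p q : ℝ) : GL (Fin 2) ℝ where
  val := !![p, -(p * q) - 1; 1, -q]
  inv := !![-q, p * q + 1; -1, p]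
  val_inv := by
    ext i j
    fin_cases i <;> fin_cases j <;> simp [Matrix.mul_apply, Fin.sum_univ_two] <;> ring
  inv_val := by
    ext i j
    fin_cases i <;> fin_cases j <;> simp [Matrix.mul_apply, Fin.sum_univ_two] <;> ring

/-- Up to sign, a Möbius letter sends `(u, v)` to `(a * s - v, s)` with `s = u - b * v`. -/
theorem schottky_step {a b : ℝ} {x y : Fin 2 → ℝ}
    (hy : (y 0 = a * (x 0 - b * x 1) - x 1 ∧ y 1 = x 0 - b * x 1) ∨
      (y 0 = -(a * (x 0 - b * x 1) - x 1) ∧ y 1 = -(x 0 - b * x 1)))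
    (hx : |x 1| < |x 0 - b * x 1|) : |y 0 - a * y 1| ≤ |y 1| ∧ y 1 ≠ 0 := by
  have hs : x 0 - b * x 1 ≠ 0 := abs_pos.1 ((abs_nonneg _).trans_lt hx)
  obtain ⟨h0, h1⟩ | ⟨h0, h1⟩ := hy
  · have e : y 0 - a * y 1 = -x 1 := by rw [h0, h1]; ring
    rw [e, h1, abs_neg]
    exact ⟨hx.le, hs⟩
  · have e : y 0 - a * y 1 = x 1 := by rw [h0, h1]; ring
    rw [e, h1, abs_neg]
    exact ⟨hx.le, neg_ne_zero.2 hs⟩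

/-- Schottky matrices with unit intervals around points at mutual distance greater than two are
free generators. -/
theorem injective_lift_schottky (c : κ × Bool → ℝ) (hc : ∀ p q, p ≠ q → 2 < |c p - c q|) :
    Function.Injective (FreeGroup.lift fun i => schottky (c (i, true)) (c (i, false))) := by
  classical
  set A : κ → GL (Fin 2) ℝ := fun i => schottky (c (i, true)) (c (i, false)) with hA
  have step (i : κ) (b : Bool) (x : Fin 2 → ℝ) (hx : |x 1| < |x 0 - c (i, !b) * x 1|) :
      let y := (cond b (A i) (A i)⁻¹ : GL (Fin 2) ℝ).val *ᵥ x
      |y 0 - c (i, b) * y 1| ≤ |y 1| ∧ y 1 ≠ 0 := by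
    refine schottky_step ?_ hx
    cases b with
    | true =>
      left
      constructor <;> simp [hA, schottky, Matrix.mulVec, dotProduct, Fin.sum_univ_two] <;> ring
    | false =>
      right
      have hinv : ((A i)⁻¹ : GL (Fin 2) ℝ).val =
        !![-c (i, false), c (i, true) * c (i, false) + 1; -1, c (i, true)] := rfl
      constructor <;> simp [hinv, Matrix.mulVec, dotProduct, Fin.sum_univ_two] <;> ring
  have key (L : List (κ × Bool)) (p : κ × Bool) (hL : FreeGroup.IsReduced (p :: L)) :
      let y := (FreeGroup.lift A (FreeGroup.mk (p :: L))).val *ᵥ ![1, 0]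
      |y 0 - c p * y 1| ≤ |y 1| ∧ y 1 ≠ 0 := by
    induction L generalizing p with
    | nil => simpa using step p.1 p.2 ![1, 0] (by simp)
    | cons q L ih =>
      rw [FreeGroup.isReduced_cons_cons] at hL
      obtain ⟨h0, h1⟩ := ih q hL.2
      set x := (FreeGroup.lift A (FreeGroup.mk (q :: L))).val *ᵥ ![1, 0] with hxdef
      have hne : q ≠ (p.1, !p.2) := by
        rintro rfl
        simpa using hL.1 rfl
      have hx : |x 1| < |x 0 - c (p.1, !p.2) * x 1| := by
        have hpos := abs_pos.2 h1
        have hmul : 2 * |x 1| < |c q - c (p.1, !p.2)| * |x 1| :=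
          mul_lt_mul_of_pos_right (hc _ _ hne) hpos
        rw [← abs_mul] at hmul
        have htri := abs_sub (x 0 - c (p.1, !p.2) * x 1) (x 0 - c q * x 1)
        have e : x 0 - c (p.1, !p.2) * x 1 - (x 0 - c q * x 1) = (c q - c (p.1, !p.2)) * x 1 := by
          ring
        rw [e] at htri
        linarith
      have hmul : (FreeGroup.lift A (FreeGroup.mk (p :: q :: L))).val *ᵥ ![1, 0] =
          (cond p.2 (A p.1) (A p.1)⁻¹ : GL (Fin 2) ℝ).val *ᵥ x := by
        rw [hxdef, Matrix.mulVec_mulVec, ← Units.val_mul]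
        simp [FreeGroup.lift_mk]
      rw [hmul]
      exact step p.1 p.2 x hx
  rw [injective_iff_map_eq_one]
  intro w hw
  by_contra hne
  obtain ⟨p, L, hpL⟩ := List.exists_cons_of_ne_nil (mt FreeGroup.toWord_eq_nil_iff.1 hne)
  have hred := FreeGroup.isReduced_toWord (x := w)
  rw [hpL] at hred
  have h := (key L p hred).2
  rw [← hpL, FreeGroup.mk_toWord, hw] at h
  simp at h

/-- The block-diagonal embedding `g ↦ diag(g, 1)` of general linear groups. -/
def blockOneHom (m l : ℕ) : GL (Fin m) R →* GL (Fin (m + l)) R :=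
  Units.map <| (Matrix.reindexAlgEquiv R R
      (finSumFinEquiv : Fin m ⊕ Fin l ≃ Fin (m + l))).toMulEquiv.toMonoidHom.comp
    { toFun := fun A => Matrix.fromBlocks A 0 0 (1 : Matrix (Fin l) (Fin l) R)
      map_one' := Matrix.fromBlocks_one
      map_mul' := fun A B => by simp [Matrix.fromBlocks_multiply] }

theorem blockOneHom_injective (m l : ℕ) :
    Function.Injective (blockOneHom m l : GL (Fin m) R →* GL (Fin (m + l)) R) := by
  refine Units.map_injective fun A B (h : Matrix.reindexAlgEquiv R R finSumFinEquiv _ = _) => ?_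
  have h' := (Matrix.reindexAlgEquiv R R finSumFinEquiv).injective h
  exact (Matrix.fromBlocks_inj.1 h').1

theorem exists_injective_lift_GL {n : ℕ} (hn : 2 ≤ n) (k : ℕ) :
    ∃ A : Fin k → GL (Fin n) ℝ, Function.Injective (FreeGroup.lift A) := by
  obtain ⟨l, rfl⟩ := Nat.exists_eq_add_of_le hn
  let e : Fin k × Bool → ℤ := fun p => 2 * (p.1 : ℤ) + if p.2 then 1 else 0
  have he (p q) (hpq : p ≠ q) : 1 ≤ |e p - e q| := by
    refine Int.one_le_abs (sub_ne_zero.2 fun h => hpq ?_)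
    obtain ⟨i, b⟩ := p
    obtain ⟨j, d⟩ := q
    cases b <;> cases d <;> simp [e, Fin.ext_iff] at h ⊢ <;> omega
  have hinj := injective_lift_schottky (fun p => 3 * (e p : ℝ)) fun p q hpq => by
    have h : (1 : ℝ) ≤ |(e p : ℝ) - e q| := by exact_mod_cast he p q hpq
    rw [← mul_sub, abs_mul, abs_of_pos (by norm_num : (0 : ℝ) < 3)]
    linarith
  refine ⟨fun i => blockOneHom 2 l
    (schottky (3 * (e (i, true) : ℝ)) (3 * (e (i, false) : ℝ))), ?_⟩
  have hcomp : FreeGroup.lift (fun i => blockOneHom 2 l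
      (schottky (3 * (e (i, true) : ℝ)) (3 * (e (i, false) : ℝ)))) =
      (blockOneHom 2 l).comp (FreeGroup.lift fun i =>
        schottky (3 * (e (i, true) : ℝ)) (3 * (e (i, false) : ℝ))) := by
    ext1 i
    simp
  rw [hcomp, MonoidHom.coe_comp]
  exact (blockOneHom_injective 2 l).comp hinj

theorem volume_relator_eq_zero {n : ℕ} (hn : 2 ≤ n) {k : ℕ} {w : FreeGroup (Fin k)} (hw : w ≠ 1) :
    volume {x : Fin k → Fin n → Fin n → ℝ |
      relator (fun i => Matrix.of (x i)) w.toWord = 0} = 0 := by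
  obtain ⟨A, hA⟩ := exists_injective_lift_GL hn k
  have hne : relator (fun i => (A i : Matrix (Fin n) (Fin n) ℝ)) w.toWord ≠ 0 := by
    rw [Ne, relator_coe_eq_zero_iff, FreeGroup.mk_toWord, ← map_one (FreeGroup.lift A), hA.eq_iff]
    exact hw
  have hclosed : IsClosed {x : Fin k → Fin n → Fin n → ℝ |
      relator (fun i => Matrix.of (x i)) w.toWord = 0} :=
    isClosed_singleton.preimage (continuous_relator (R := ℝ) (ι := Fin n) w.toWord)
  have : (volume : Measure (Fin n → Fin n → ℝ)).IsAddHaarMeasure :=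
    Measure.pi.isAddHaarMeasure _
  have : (volume : Measure (Fin k → Fin n → Fin n → ℝ)).IsAddHaarMeasure :=
    Measure.pi.isAddHaarMeasure _
  exact addHaar_eq_zero_of_countable_lines volume hclosed.measurableSet
    (fun i => (A i : Matrix (Fin n) (Fin n) ℝ)) fun v =>
      (finite_relator_line_eq_zero hne fun i => Matrix.of (v i)).countable

end Matrix

/-- For `n ≥ 2` and `k ≥ 1`, the set of `k`-tuples of matrices in `GL(n,ℝ)` that do not
form a free basis of the subgroup they generate (i.e. for which the homomorphism from the
free group of rank `k` sending the `i`-th free generator to the `i`-th matrix fails to be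
injective) has Lebesgue measure zero as a subset of `(Mₙ(ℝ))^k ≅ ℝ^{kn²}`. -/
theorem generic_matrix_tuples_free (n k : ℕ) (hn : 2 ≤ n) (hk : 1 ≤ k) :
    MeasureTheory.volume
      {x : Fin k → (Fin n → Fin n → ℝ) |
        ∃ A : Fin k → GL (Fin n) ℝ,
          (∀ i, (A i : Matrix (Fin n) (Fin n) ℝ) = Matrix.of (x i)) ∧
          ¬ Function.Injective (FreeGroup.lift A)} = 0 := by
  refine measure_mono_null (t := ⋃ w : {w : FreeGroup (Fin k) // w ≠ 1},
    {x | Matrix.relator (fun i => Matrix.of (x i)) w.1.toWord = 0}) ?_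
    (measure_iUnion_null fun w => Matrix.volume_relator_eq_zero hn w.2)
  rintro x ⟨A, hA, hinj⟩
  rw [injective_iff_map_eq_one] at hinj
  push Not at hinj
  obtain ⟨w, hw, hw1⟩ := hinj
  refine Set.mem_iUnion.2 ⟨⟨w, hw1⟩, ?_⟩
  have h := (Matrix.relator_coe_eq_zero_iff A w.toWord).2 (by rwa [FreeGroup.mk_toWord])
  simp only [hA] at h
  exact h
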